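/- arXiv:1810.13102 — 2 statements merged into one kernel-verified Lean document; each statement's English description precedes it below -/
import Mathlib

section
/- Let X be a complex Banach space and let u, v : ℝ → X be uniformly continuous. Then there exists y ∈ C₀(ℝ,X) such that sup_{t∈ℝ} ‖u(t) − y(t)‖ ≤ sup_{t∈ℝ} ‖u(t) + g(t)·v(t)‖, where both suprema are computed in [0,∞]. -/
open Filter ENNReal

noncomputable def g (t : ℝ) : ℂ := Complex.exp (Complex.I * (t : ℂ) ^ 2)

lemma aux_s (t : ℝ) (ht : t ≠ 0) : ∃ s : ℝ, s ^ 2 = t ^ 2 + Real.pi ∧ |s - t| ≤ Real.pi / |t| := by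
  have key : ∀ a : ℝ, 0 < a → ∃ s : ℝ, s ^ 2 = a ^ 2 + Real.pi ∧ |s - a| ≤ Real.pi / a := by
    intro a ha
    have hp := Real.pi_pos
    refine ⟨Real.sqrt (a ^ 2 + Real.pi), Real.sq_sqrt (by positivity), ?_⟩
    have h1 : a ≤ Real.sqrt (a ^ 2 + Real.pi) := Real.le_sqrt_of_sq_le (by linarith)
    have h2 : Real.sqrt (a ^ 2 + Real.pi) ^ 2 = a ^ 2 + Real.pi := Real.sq_sqrt (by positivity)
    rw [abs_of_nonneg (by linarith), le_div_iff₀ ha]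
    nlinarith
  rcases lt_or_gt_of_ne ht with h | h
  · obtain ⟨s, h1, h2⟩ := key (-t) (by linarith)
    refine ⟨-s, by nlinarith, ?_⟩
    rw [abs_of_neg h, ← abs_neg]
    convert h2 using 2
    ring
  · rw [abs_of_pos h]
    exact key t h

lemma g_norm (t : ℝ) : ‖g t‖ = 1 := by
  unfold g
  have : Complex.I * (t : ℂ) ^ 2 = ((t ^ 2 : ℝ) : ℂ) * Complex.I := by push_cast; ring
  rw [this, Complex.norm_exp_ofReal_mul_I]

lemma g_neg (s t : ℝ) (h : s ^ 2 = t ^ 2 + Real.pi) : g s = - g t := by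
  unfold g
  have h' : (s : ℂ) ^ 2 = (t : ℂ) ^ 2 + Real.pi := by exact_mod_cast h
  rw [h', mul_add, Complex.exp_add, mul_comm Complex.I (Real.pi : ℂ), Complex.exp_pi_mul_I]
  ring

lemma aux_bound {X : Type*} [NormedAddCommGroup X] [NormedSpace ℂ X]
    (u v : ℝ → X) (hu : UniformContinuous u) (hv : UniformContinuous v) (M : ℝ)
    (hM : ∀ t, ‖u t + g t • v t‖ ≤ M) (ε : ℝ) (hε : 0 < ε) :
    ∃ R : ℝ, ∀ t, R < |t| → ‖u t‖ ≤ M + ε := by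
  obtain ⟨d1, hd1, h1⟩ := Metric.uniformContinuous_iff.1 hu ε hε
  obtain ⟨d2, hd2, h2⟩ := Metric.uniformContinuous_iff.1 hv ε hε
  have hp := Real.pi_pos
  have hd : 0 < min d1 d2 := lt_min hd1 hd2
  refine ⟨Real.pi / min d1 d2, fun t ht => ?_⟩
  have ht0 : 0 < |t| := lt_trans (by positivity) ht
  obtain ⟨s, hs, hst⟩ := aux_s t (abs_pos.1 ht0)
  have hlt : |s - t| < min d1 d2 := by
    refine lt_of_le_of_lt hst ?_
    rw [div_lt_iff₀ hd] at ht
    rw [div_lt_iff₀ ht0]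
    linarith
  have e1 : ‖u s - u t‖ < ε := by
    rw [← dist_eq_norm]
    exact h1 (by rw [Real.dist_eq]; exact hlt.trans_le (min_le_left _ _))
  have e2 : ‖v s - v t‖ < ε := by
    rw [← dist_eq_norm]
    exact h2 (by rw [Real.dist_eq]; exact hlt.trans_le (min_le_right _ _))
  have a1 := hM t
  have a2 := hM s
  rw [g_neg s t hs] at a2
  have e3 : ‖g t • (v s - v t)‖ < ε := by rw [norm_smul, g_norm, one_mul]; exact e2
  have eq : u t + u t = (u t + g t • v t) + (u s + (- g t) • v s) - (u s - u t)
      + g t • (v s - v t) := by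
    rw [smul_sub, neg_smul]; abel
  have n1 : ‖u t + u t‖ = 2 * ‖u t‖ := by
    rw [← two_smul ℂ, norm_smul]; simp
  have n2 : ‖u t + u t‖ ≤ ‖u t + g t • v t‖ + ‖u s + (- g t) • v s‖ + ‖u s - u t‖
      + ‖g t • (v s - v t)‖ := by
    rw [eq]
    refine (norm_add_le _ _).trans ?_
    gcongr
    refine (norm_sub_le _ _).trans ?_
    gcongr
    exact norm_add_le _ _
  linarith

lemma aux_tendsto {X : Type*} [NormedAddCommGroup X] (y : ℝ → X)
    (h : ∀ ε : ℝ, 0 < ε → ∃ R : ℝ, ∀ t, R < |t| → ‖y t‖ ≤ ε) :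
    Tendsto (fun t => ‖y t‖) (cocompact ℝ) (nhds 0) := by
  rw [Metric.tendsto_nhds]
  intro ε hε
  obtain ⟨R, hR⟩ := h (ε / 2) (by linarith)
  have := (tendsto_norm_cocompact_atTop (E := ℝ)).eventually (eventually_gt_atTop R)
  filter_upwards [this] with t ht
  have := hR t ht
  simp only [dist_zero_right, norm_norm]
  linarith

theorem stmt2 (X : Type*) [NormedAddCommGroup X] [NormedSpace ℂ X] [CompleteSpace X]
    (u v : ℝ → X) (hu : UniformContinuous u) (hv : UniformContinuous v) :
    ∃ y : ℝ → X, Continuous y ∧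
      Tendsto (fun t => ‖y t‖) (cocompact ℝ) (nhds 0) ∧
      (⨆ t : ℝ, (‖u t - y t‖₊ : ℝ≥0∞)) ≤ (⨆ t : ℝ, (‖u t + g t • v t‖₊ : ℝ≥0∞)) := by
  generalize hK : (⨆ t : ℝ, (‖u t + g t • v t‖₊ : ℝ≥0∞)) = K
  by_cases hT : K = ⊤
  · exact ⟨fun _ => 0, continuous_const, by simp, by simp [hT]⟩
  lift K to NNReal using hT
  have hM : ∀ t, ‖u t + g t • v t‖ ≤ (K : ℝ) := by
    intro t
    have := le_iSup (fun t : ℝ => (‖u t + g t • v t‖₊ : ℝ≥0∞)) t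
    rw [hK] at this
    exact_mod_cast this
  have hb := aux_bound u v hu hv K hM
  rcases eq_or_lt_of_le K.2 with h0 | hpos
  · refine ⟨u, hu.continuous, aux_tendsto u fun ε hε => ?_, by simp⟩
    obtain ⟨R, hR⟩ := hb ε hε
    refine ⟨R, fun t ht => ?_⟩
    have := hR t ht
    change (0 : ℝ) = (K : ℝ) at h0
    linarith
  change (0 : ℝ) < (K : ℝ) at hpos
  have hmax : ∀ t, 0 < max (K : ℝ) ‖u t‖ := fun t => lt_max_of_lt_left hpos
  let _ : NormedSpace ℝ X := NormedSpace.restrictScalars ℝ ℂ X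
  refine ⟨fun t => u t - ((K : ℝ) / max (K : ℝ) ‖u t‖) • u t, ?_, aux_tendsto _ fun ε hε => ?_, ?_⟩
  · have := hu.continuous
    have hc : Continuous fun t => (K : ℝ) / max (K : ℝ) ‖u t‖ :=
      continuous_const.div (continuous_const.max this.norm) fun t => (hmax t).ne'
    exact this.sub (hc.smul this)
  · obtain ⟨R, hR⟩ := hb ε hε
    refine ⟨R, fun t ht => ?_⟩
    have h1 := hR t ht
    have hm := hmax t
    have h2 : max (K : ℝ) ‖u t‖ ≤ K + ε := max_le (by linarith) h1
    have h3 := le_max_left (K : ℝ) ‖u t‖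
    have h4 := le_max_right (K : ℝ) ‖u t‖
    have : u t - ((K : ℝ) / max (K : ℝ) ‖u t‖) • u t
        = ((max (K : ℝ) ‖u t‖ - K) / max (K : ℝ) ‖u t‖) • u t := by
      rw [sub_div, div_self hm.ne', sub_smul, one_smul]
    rw [this, norm_smul, Real.norm_of_nonneg (div_nonneg (by linarith) hm.le), div_mul_eq_mul_div,
      div_le_iff₀ hm]
    exact mul_le_mul (by linarith) h4 (norm_nonneg _) hε.le
  · refine iSup_le fun t => ?_
    have hm := hmax t
    have h4 := le_max_right (K : ℝ) ‖u t‖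
    rw [_root_.sub_sub_cancel]
    have : ‖((K : ℝ) / max (K : ℝ) ‖u t‖) • u t‖ ≤ K := by
      rw [norm_smul, Real.norm_of_nonneg (div_nonneg hpos.le hm.le), div_mul_eq_mul_div,
        div_le_iff₀ hm]
      exact mul_le_mul_of_nonneg_left h4 hpos.le
    exact_mod_cast this
end

section
/- Let X be a Banach space and let φ : ℝ → X be a function such that Δ_h φ ∈ C₀(ℝ,X) for every h > 0. Then φ is uniformly continuous. -/
open Filter

theorem aux_mean (X : Type*) [NormedAddCommGroup X] [NormedSpace ℝ X] [CompleteSpace X]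
    (φ : ℝ → X)
    (h : ∀ h' > (0:ℝ), Continuous (fun t => φ (t + h') - φ t) ∧
      Tendsto (fun t => ‖φ (t + h') - φ t‖) (cocompact ℝ) (nhds 0))
    (L s : ℝ) (hL : 0 < L) (hs : 0 < s) (t : ℝ) :
    ∫ x in t..(t+L), (φ (x + s) - φ x) = ∫ x in t..(t+s), (φ (x + L) - φ x) := by
  have der : ∀ (f : ℝ → X) (_ : Continuous f) (a t : ℝ),
      HasDerivAt (fun t => ∫ x in t..(t+a), f x) (f (t+a) - f t) t := by
    intro f hf a t
    have e : (fun t => ∫ x in t..(t+a), f x)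
        = fun t => (∫ x in (0:ℝ)..(t+a), f x) - ∫ x in (0:ℝ)..t, f x := by
      funext t
      exact (intervalIntegral.integral_interval_sub_left
        (hf.intervalIntegrable _ _) (hf.intervalIntegrable _ _)).symm
    rw [e]
    have d : ∀ t, HasDerivAt (fun t => ∫ x in (0:ℝ)..t, f x) (f t) t := fun t =>
      hf.integral_hasStrictDerivAt 0 t |>.hasDerivAt
    exact ((d (t+a)).comp_add_const t a).sub (d t)
  have lim : ∀ (f : ℝ → X) (_ : Tendsto (fun t => ‖f t‖) (cocompact ℝ) (nhds 0)) (a : ℝ)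
      (_ : 0 < a), Tendsto (fun t => ∫ x in t..(t+a), f x) atTop (nhds 0) := by
    intro f hf a ha
    have hf' : Tendsto (fun t => ‖f t‖) atTop (nhds 0) := hf.mono_left atTop_le_cocompact
    rw [Metric.tendsto_atTop]
    intro ε hε
    rw [Metric.tendsto_atTop] at hf'
    obtain ⟨N, hN⟩ := hf' (ε / (2 * a)) (by positivity)
    refine ⟨N, fun t ht => ?_⟩
    rw [dist_zero_right]
    have := intervalIntegral.norm_integral_le_of_norm_le_const (f := f) (a := t) (b := t + a)
      (C := ε / (2*a)) (by
        intro x hx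
        rw [Set.uIoc_of_le (by linarith)] at hx
        have := hN x (by linarith [hx.1])
        rw [dist_zero_right, norm_norm] at this
        exact this.le)
    refine this.trans_lt ?_
    rw [add_sub_cancel_left, abs_of_pos ha]
    field_simp
    linarith
  set F : ℝ → X := fun t => (∫ x in t..(t+L), (φ (x + s) - φ x))
    - ∫ x in t..(t+s), (φ (x + L) - φ x) with hF
  have hd : ∀ t, HasDerivAt F 0 t := by
    intro t
    have := (der _ (h s hs).1 L t).sub (der _ (h L hL).1 s t)
    convert this using 1
    · rfl
    · rw [add_right_comm t L s]
      abel
  have hl : Tendsto F atTop (nhds 0) := by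
    simpa using (lim _ (h s hs).2 L hL).sub (lim _ (h L hL).2 s hs)
  have hc : ∀ x, F x = F t := fun x =>
    is_const_of_deriv_eq_zero (fun y => (hd y).differentiableAt) (fun y => (hd y).deriv) x t
  have : F t = 0 := by
    refine tendsto_nhds_unique (f := F) ?_ hl
    rw [show F = fun _ => F t from funext hc]
    exact tendsto_const_nhds
  exact sub_eq_zero.mp this

theorem stmt8 (X : Type*) [NormedAddCommGroup X] [NormedSpace ℝ X] [CompleteSpace X]
    (φ : ℝ → X)
    (h : ∀ h' > (0:ℝ), Continuous (fun t => φ (t + h') - φ t) ∧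
      Tendsto (fun t => ‖φ (t + h') - φ t‖) (cocompact ℝ) (nhds 0)) :
    UniformContinuous φ := by
  have key : ∀ ε > (0:ℝ), ∃ δ > (0:ℝ), ∀ s, 0 < s → s < δ → ∀ t, ‖φ (t + s) - φ t‖ < ε := by
    by_contra! hcon
    obtain ⟨ε, hε, hcon⟩ := hcon
    choose s hs0 hs1 t ht using fun n : ℕ => hcon (1 / ((n:ℝ) + 1)) (by positivity)
    have hslim : Tendsto s atTop (nhds 0) :=
      squeeze_zero (fun n => (hs0 n).le) (fun n => (hs1 n).le)
        tendsto_one_div_add_atTop_nhds_zero_nat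
    set u : ℕ → ℝ → X := fun n t => φ (t + s n) - φ t with hu
    have uc : ∀ n, Continuous (u n) := fun n => (h _ (hs0 n)).1
    have unif : ∀ r > (0:ℝ), ∀ η > (0:ℝ), ∃ N, ∀ n ≥ N, ∀ t, ‖u n (t + r) - u n t‖ ≤ η := by
      intro r hr η hη
      have U : UniformContinuous (fun t => φ (t + r) - φ t) :=
        (h r hr).1.uniformContinuous_of_tendsto_cocompact
          (tendsto_zero_iff_norm_tendsto_zero.mpr (h r hr).2)
      obtain ⟨δ, hδ, H⟩ := Metric.uniformContinuous_iff.mp U η hη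
      obtain ⟨N, hN⟩ := Metric.tendsto_atTop.mp hslim δ hδ
      refine ⟨N, fun n hn t => ?_⟩
      have := H (a := t + s n) (b := t) (by
        have := hN n hn
        rw [dist_zero_right] at this
        rwa [dist_eq_norm, add_sub_cancel_left])
      rw [dist_eq_norm] at this
      refine le_trans (le_of_eq ?_) this.le
      congr 1
      simp only [hu]
      rw [add_right_comm t r (s n)]
      abel
    let E : ℕ → Set ℝ := fun N => {r | ∀ n ≥ N, ∀ t, ‖u n (t + Real.exp r) - u n t‖ ≤ ε / 4}
    have Ecl : ∀ N, IsClosed (E N) := by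
      intro N
      simp only [E, Set.setOf_forall]
      refine isClosed_iInter fun n => isClosed_iInter fun _ => isClosed_iInter fun t => ?_
      have := uc n
      exact isClosed_le (by fun_prop) continuous_const
    have EU : ⋃ N, E N = Set.univ := by
      refine Set.eq_univ_of_forall fun r => Set.mem_iUnion.mpr ?_
      exact unif _ (Real.exp_pos r) _ (by positivity)
    obtain ⟨N, r0, hr0⟩ := nonempty_interior_of_iUnion_of_closed Ecl EU
    obtain ⟨d, hd, hball⟩ := Metric.isOpen_iff.mp isOpen_interior r0 hr0
    -- interval
    set a := Real.exp r0 with ha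
    set L := Real.exp (r0 + d/2) - a with hLdef
    have hL : 0 < L := sub_pos.mpr (Real.exp_lt_exp.mpr (by linarith))
    have hI : ∀ r, a ≤ r → r ≤ a + L → ∀ n ≥ N, ∀ t, ‖u n (t + r) - u n t‖ ≤ ε / 4 := by
      intro r h1 h2
      have hr : 0 < r := (Real.exp_pos r0).trans_le h1
      have m : Real.log r ∈ E N := by
        apply interior_subset
        apply hball
        have e1 : r0 ≤ Real.log r := (Real.le_log_iff_exp_le hr).mpr h1
        have e2 : Real.log r ≤ r0 + d/2 := (Real.log_le_iff_le_exp hr).mpr (by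
          rw [hLdef] at h2; linarith)
        rw [Metric.mem_ball, Real.dist_eq, abs_lt]
        constructor <;> linarith
      have := m
      simp only [E, Set.mem_setOf_eq, Real.exp_log hr] at this
      exact this
    obtain ⟨C, hC⟩ : ∃ C, ∀ x, ‖φ (x + L) - φ x‖ ≤ C := by
      let G : ZeroAtInftyContinuousMap ℝ X := ⟨⟨fun t => φ (t + L) - φ t, (h L hL).1⟩,
        tendsto_zero_iff_norm_tendsto_zero.mpr (h L hL).2⟩
      exact ⟨‖G.toBCF‖, fun x => G.toBCF.norm_coe_le_norm x⟩
    have hCs : Tendsto (fun n => C * s n) atTop (nhds 0) := by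
      simpa using hslim.const_mul C
    obtain ⟨n, hn1, hn2⟩ := ((eventually_ge_atTop N).and
      (hCs.eventually_lt_const (show 0 < L * (ε / 4) by positivity))).exists
    set τ := t n + a with hτ
    have i1 : ‖∫ x in τ..(τ+L), u n x‖ ≤ C * s n := by
      have e := aux_mean X φ h L (s n) hL (hs0 n) τ
      simp only [hu]
      rw [e]
      have := intervalIntegral.norm_integral_le_of_norm_le_const
        (f := fun x => φ (x + L) - φ x) (a := τ) (b := τ + s n) (C := C) (fun x _ => hC x)
      rwa [add_sub_cancel_left, abs_of_pos (hs0 n)] at this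
    have i2 : ‖∫ x in τ..(τ+L), (u n x - u n (t n))‖ ≤ ε / 4 * L := by
      have := intervalIntegral.norm_integral_le_of_norm_le_const
        (f := fun x => u n x - u n (t n)) (a := τ) (b := τ + L) (C := ε / 4) (by
          intro x hx
          rw [Set.uIoc_of_le (by linarith)] at hx
          have := hI (x - t n) (by linarith [hx.1]) (by linarith [hx.2]) n hn1 (t n)
          rwa [add_sub_cancel] at this)
      rwa [add_sub_cancel_left, abs_of_pos hL] at this
    rw [intervalIntegral.integral_sub ((uc n).intervalIntegrable _ _)
      (continuous_const.intervalIntegrable _ _), intervalIntegral.integral_const,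
      add_sub_cancel_left] at i2
    have i3 : ‖L • u n (t n)‖ ≤ C * s n + ε / 4 * L := by
      have := norm_sub_le (∫ x in τ..(τ+L), u n x) ((∫ x in τ..(τ+L), u n x) - L • u n (t n))
      rw [sub_sub_cancel] at this
      linarith
    rw [norm_smul, Real.norm_of_nonneg hL.le] at i3
    have i4 : L * ε ≤ L * ‖u n (t n)‖ := mul_le_mul_of_nonneg_left (ht n) hL.le
    nlinarith [mul_pos hL hε]
  rw [Metric.uniformContinuous_iff]
  intro ε hε
  obtain ⟨δ, hδ, H⟩ := key ε hε
  refine ⟨δ, hδ, fun {x y} hxy => ?_⟩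
  rw [Real.dist_eq, abs_lt] at hxy
  rcases lt_trichotomy x y with hlt | rfl | hlt
  · have := H (y - x) (by linarith) (by linarith) x
    rw [add_sub_cancel] at this
    rwa [dist_comm, dist_eq_norm]
  · simpa using hε
  · have := H (x - y) (by linarith) (by linarith) y
    rw [add_sub_cancel] at this
    rwa [dist_eq_norm]
end
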